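/- Let G be an isometric multiple HNN extension of a finitely presented base group (A,X) whose base group has the synchronous falsification by fellow traveler property with (even integer) constant k, and let M = max{|u_{ij}| : i ∈ [1,n], j ∈ [1,m_i]} be the maximal word length of a free generator of an associated subgroup. Then G is almost convex with respect to X ∪ {s_1,…,s_n} with almost convexity constant at most max{6k + 2, 4M}. -/

import Mathlib

/-!  Common framework: words over an inverse-closed generating set, word length,
geodesics, falsification by fellow traveler property, almost convexity. -/

namespace ACPaper

section Core

variable {β G : Type*} [Group G]

/-- A letter is a generator (`Sum.inl`) or the formal inverse of a generator (`Sum.inr`);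
this realizes the inverse-closed alphabet `X^{±1}`. -/
def letterEval (gen : β → G) : β ⊕ β → G :=
  Sum.elim gen fun b => (gen b)⁻¹

/-- Evaluation of a word over `X^{±1}` in the group. -/
def eval (gen : β → G) (w : List (β ⊕ β)) : G :=
  (w.map (letterEval gen)).prod

/-- `gen` is a generating set: every element is represented by some word. -/
def Generates (gen : β → G) : Prop :=
  ∀ g : G, ∃ w : List (β ⊕ β), eval gen w = g

/-- Word length of a group element with respect to the generating set. -/
noncomputable def wlen (gen : β → G) (g : G) : ℕ :=
  sInf {n : ℕ | ∃ w : List (β ⊕ β), eval gen w = g ∧ w.length = n}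

/-- A word is geodesic if its length equals the word length of the element it represents. -/
def IsGeodesic (gen : β → G) (w : List (β ⊕ β)) : Prop :=
  w.length = wlen gen (eval gen w)

/-- The point reached after `t` steps along the unit-speed path labelled by `w`
(the path remains at its endpoint after time `w.length`). -/
def pos (gen : β → G) (w : List (β ⊕ β)) (t : ℕ) : G :=
  eval gen (w.take t)

/-- Synchronous falsification by fellow traveler property with constant `k`:
every non-geodesic word is synchronously `k`-fellow traveled by a shorter word
representing the same element. -/
def SynchFFTP (gen : β → G) (k : ℕ) : Prop :=
  ∀ w : List (β ⊕ β), ¬ IsGeodesic gen w →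
    ∃ w' : List (β ⊕ β), eval gen w' = eval gen w ∧ w'.length < w.length ∧
      ∀ t : ℕ, wlen gen ((pos gen w t)⁻¹ * pos gen w' t) ≤ k

/-- The path starting at `g` labelled by the word `w` stays in the ball of radius `N`
about the identity. -/
def PathInBall (gen : β → G) (N : ℕ) (g : G) (w : List (β ⊕ β)) : Prop :=
  ∀ t : ℕ, wlen gen (g * pos gen w t) ≤ N

/-- Almost convexity with constant `C`: any two elements of the sphere of radius `N ≥ 1`
at distance at most `2` are joined by a path of length at most `C` inside the ball of
radius `N`. -/
def AlmostConvexWith (gen : β → G) (C : ℕ) : Prop :=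
  ∀ N : ℕ, 1 ≤ N → ∀ g g' : G, wlen gen g = N → wlen gen g' = N →
    wlen gen (g⁻¹ * g') ≤ 2 →
    ∃ w : List (β ⊕ β), g * eval gen w = g' ∧ w.length ≤ C ∧ PathInBall gen N g w

/-- Almost convexity: almost convex with some positive constant. -/
def AlmostConvex (gen : β → G) : Prop :=
  ∃ C : ℕ, 0 < C ∧ AlmostConvexWith gen C

end Core

/-- Two letters are an inverse pair (`x` followed by `x⁻¹`, or `x⁻¹` followed by `x`). -/
def IsInvPair {β : Type*} : β ⊕ β → β ⊕ β → Prop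
  | Sum.inl x, Sum.inr y => x = y
  | Sum.inr x, Sum.inl y => x = y
  | _, _ => False

/-- A word over a formal alphabet `κ^{±1}` is freely reduced. -/
def FreelyReduced {κ : Type*} (l : List (κ ⊕ κ)) : Prop :=
  l.Chain' fun a b => ¬ IsInvPair a b

/-- Every geodesic word (over `X^{±1}`) representing an element of the subgroup generated
by `gens` is a concatenation of geodesic words, each representing an element of `gens` or
an inverse of one. -/
def TGConcat {β G : Type*} [Group G] (gen : β → G) (gens : Set G) : Prop :=
  ∀ w : List (β ⊕ β), IsGeodesic gen w → eval gen w ∈ Subgroup.closure gens →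
    ∃ ps : List (List (β ⊕ β)), w = ps.flatten ∧
      ∀ p ∈ ps, IsGeodesic gen p ∧ ∃ g ∈ gens, eval gen p = g ∨ eval gen p = g⁻¹

/-- Every freely reduced word in the elements `f j` and their inverses, read as a word over
`X^{±1}` (i.e. substituting geodesic representatives), is geodesic: the word length of the
element it represents is the sum of the word lengths of its letters. -/
def TGReducedGeodesic {β G κ : Type*} [Group G] (gen : β → G) (f : κ → G) : Prop :=
  ∀ l : List (κ ⊕ κ), FreelyReduced l →
    wlen gen (eval f l) =
      (l.map (Sum.elim (fun j => wlen gen (f j)) fun j => wlen gen (f j))).sum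

/-- The subgroup generated by the family `f` is totally geodesic in `(G, gen)`. -/
def TotallyGeodesicSub {β G κ : Type*} [Group G] (gen : β → G) (f : κ → G) : Prop :=
  TGConcat gen (Set.range f) ∧ TGReducedGeodesic gen f

/-- The data of a multiple HNN extension: a finitely generated base group
`A = ⟨X ∣ R⟩` and, for each stable letter `s_i` (`i ∈ Fin n`), words
`uw i j, vw i j` over `X` spelling the generators `u_{ij}` of `U_i` and
`v_{ij} = φ_i(u_{ij})` of `V_i`. -/
structure MHNNData where
  /-- the generating set of the base group -/
  X : Type
  /-- the generating set is finite -/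
  fin : Fintype X
  /-- the relators of the base group -/
  R : Set (FreeGroup X)
  /-- the number of stable letters -/
  n : ℕ
  /-- the number of free generators of each associated subgroup -/
  m : Fin n → ℕ
  /-- words spelling the free generators of the `U_i` -/
  uw : (i : Fin n) → Fin (m i) → FreeGroup X
  /-- words spelling the free generators of the `V_i` -/
  vw : (i : Fin n) → Fin (m i) → FreeGroup X

namespace MHNNData

variable (D : MHNNData)

/-- The base group `A = ⟨X ∣ R⟩`. -/
def A : Type := PresentedGroup D.R

instance : Group D.A := by unfold A; infer_instance

/-- The canonical projection `FreeGroup X → A`. -/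
def projA : FreeGroup D.X →* D.A := PresentedGroup.mk D.R

/-- The marking of the base group by its generators. -/
def genA : D.X → D.A := fun x => PresentedGroup.of x

/-- The free generators `u_{ij}` of the associated subgroup `U_i`. -/
def u (i : Fin D.n) (j : Fin (D.m i)) : D.A := D.projA (D.uw i j)

/-- The free generators `v_{ij} = φ_i(u_{ij})` of the associated subgroup `V_i`. -/
def v (i : Fin D.n) (j : Fin (D.m i)) : D.A := D.projA (D.vw i j)

/-- The associated subgroup `U_i`. -/
def U (i : Fin D.n) : Subgroup D.A := Subgroup.closure (Set.range (D.u i))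

/-- The associated subgroup `V_i`. -/
def V (i : Fin D.n) : Subgroup D.A := Subgroup.closure (Set.range (D.v i))

/-- The relators of the multiple HNN extension
`G = ⟨X, s_1, …, s_n ∣ R, s_i⁻¹ u_{ij} s_i = v_{ij}⟩`. -/
def relsG : Set (FreeGroup (D.X ⊕ Fin D.n)) :=
  FreeGroup.map Sum.inl '' D.R ∪
    { r | ∃ (i : Fin D.n) (j : Fin (D.m i)),
        r = (FreeGroup.of (Sum.inr i))⁻¹ * FreeGroup.map Sum.inl (D.uw i j) *
            FreeGroup.of (Sum.inr i) * (FreeGroup.map Sum.inl (D.vw i j))⁻¹ }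

/-- The multiple HNN extension `G`. -/
def G : Type := PresentedGroup D.relsG

instance : Group D.G := by unfold G; infer_instance

/-- The marking of `G` by the generating set `X ∪ {s_1, …, s_n}`. -/
def genG : D.X ⊕ Fin D.n → D.G := fun x => PresentedGroup.of x

/-- Each associated subgroup `U_i`, `V_i` is free with the given (finite) free basis:
the induced maps from the free group are injective. -/
def FreeBases : Prop :=
  ∀ i : Fin D.n,
    Function.Injective (FreeGroup.lift (D.u i) : FreeGroup (Fin (D.m i)) →* D.A) ∧
    Function.Injective (FreeGroup.lift (D.v i) : FreeGroup (Fin (D.m i)) →* D.A)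

/-- All associated subgroups are totally geodesic. -/
def TotallyGeodesic : Prop :=
  ∀ i : Fin D.n,
    TotallyGeodesicSub D.genA (D.u i) ∧ TotallyGeodesicSub D.genA (D.v i)

/-- The presentation is strip equidistant: `|u_{ij}| = |v_{ij}|` in `(A,X)`. -/
def StripEquidistant : Prop :=
  ∀ (i : Fin D.n) (j : Fin (D.m i)), wlen D.genA (D.u i j) = wlen D.genA (D.v i j)

/-- `G` is an isometric multiple HNN extension: the associated subgroups are finitely
generated free, totally geodesic, and strip equidistant. -/
def IsIsometric : Prop :=
  D.FreeBases ∧ D.TotallyGeodesic ∧ D.StripEquidistant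

end MHNNData

section Britton

variable {I A K : Type} [Group A] [Group K]

/-- The element `a₀ s_{i₁}^{e₁} a₁ ⋯ s_{iᵣ}^{eᵣ} aᵣ` of a group `K` containing images of the base
group `A` and of the stable letters. -/
def stableProd (ι : A →* K) (s : I → K) (a : A) (l : List (I × ℤˣ × A)) : K :=
  ι a * (l.map fun x => s x.1 ^ (x.2.1 : ℤ) * ι x.2.2).prod

/-- No adjacent stable letters `s_i^e` and `s_i^{-e}` enclose an element of the associated
subgroup `S i e`. -/
def PinchFree (S : I → ℤˣ → Subgroup A) (l : List (I × ℤˣ × A)) : Prop :=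
  l.IsChain fun x y => x.1 = y.1 → x.2.2 ∈ S x.1 x.2.1 → x.2.1 = y.2.1

theorem stableProd_cons (ι : A →* K) (s : I → K) (a b : A) (i : I) (e : ℤˣ)
    (l : List (I × ℤˣ × A)) :
    stableProd ι s a ((i, e, b) :: l) = ι a * (s i ^ (e : ℤ) * stableProd ι s b l) := by
  simp [stableProd, mul_assoc]

/-- Grouping a pinch-free word around the occurrences of one stable letter `j` gives a reduced
word of the HNN extension with stable letter `j` over a group `K` in which Britton's lemma holds
for the remaining stable letters. -/
theorem exists_reducedWord_of_pinchFree (S : I → ℤˣ → Subgroup A) (j : I) (P : I → Prop)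
    (ι : A →* K) (hι : Function.Injective ι) (s : I → K)
    (hK : ∀ a l, (∀ x ∈ l, P x.1) → PinchFree S l → stableProd ι s a l ∈ ι.range → l = [])
    (ψ : (S j 1).map ι ≃* (S j (-1)).map ι)
    (s' : I → HNNExtension K ((S j 1).map ι) ((S j (-1)).map ι) ψ)
    (hs'j : s' j = HNNExtension.t) (hs' : ∀ i, i ≠ j → s' i = HNNExtension.of (s i))
    (l : List (I × ℤˣ × A)) (hlP : ∀ x ∈ l, x.1 ≠ j → P x.1) (hl : PinchFree S l) (a : A) :
    ∃ (w : HNNExtension.NormalWord.ReducedWord K ((S j 1).map ι) ((S j (-1)).map ι))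
      (l₁ l₂ : List (I × ℤˣ × A)),
      l = l₁ ++ l₂ ∧ (∀ x ∈ l₁, P x.1) ∧ w.head = stableProd ι s a l₁ ∧
      l₂.head?.map (fun x => x.2.1) = w.toList.head?.map Prod.fst ∧
      (∀ x ∈ l₂.head?, x.1 = j) ∧
      stableProd (HNNExtension.of.comp ι) s' a l = w.prod ψ := by
  have hsub : ∀ e, HNNExtension.toSubgroup ((S j 1).map ι) ((S j (-1)).map ι) e
      = (S j e).map ι := by
    intro e
    rcases Int.units_eq_one_or e with rfl | rfl <;> rfl
  induction l generalizing a with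
  | nil =>
    exact ⟨⟨ι a, [], by simp⟩, [], [], rfl, by simp, by simp [stableProd], rfl, by simp,
      by simp [stableProd, HNNExtension.NormalWord.ReducedWord.prod]⟩
  | cons x l ih =>
    obtain ⟨i, e, b⟩ := x
    obtain ⟨w, l₁, l₂, rfl, hl₁, hw, hhead, hj, hprod⟩ :=
      ih (fun x hx => hlP x (List.mem_cons_of_mem _ hx)) hl.tail b
    by_cases hij : i = j
    · subst hij
      refine ⟨⟨ι a, (e, w.head) :: w.toList, ?_⟩, [], (i, e, b) :: (l₁ ++ l₂), rfl, by simp,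
        by simp [stableProd], by simp, by simp, ?_⟩
      · refine List.isChain_cons.2 ⟨?_, w.chain⟩
        intro y hy hmem
        simp only [hsub] at hmem
        have hrange : w.head ∈ ι.range := by
          obtain ⟨c, -, hc⟩ := hmem
          exact ⟨c, hc⟩
        have hnil : l₁ = [] := by
          refine hK b l₁ hl₁ ?_ (hw ▸ hrange)
          exact (List.IsChain.left_of_append hl.tail)
        subst hnil
        have hwb : w.head = ι b := by simpa [stableProd] using hw
        have hb : b ∈ S i e := by
          obtain ⟨c, hc, hcb⟩ := hmem
          rw [hwb] at hcb
          exact hι hcb ▸ hc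
        cases l₂ with
        | nil => rw [Option.mem_def] at hy; simp [hy] at hhead
        | cons z l₂ =>
          rw [Option.mem_def] at hy
          simp only [List.head?_cons, Option.map_some, hy, Option.some.injEq] at hhead
          have hz : z.1 = i := hj z (by simp)
          have := (List.isChain_cons.1 hl).1 z (by simp) hz.symm hb
          exact this.trans hhead
      · rw [stableProd_cons, hprod, hs'j]
        simp [HNNExtension.NormalWord.ReducedWord.prod, mul_assoc]
    · refine ⟨⟨ι a * (s i ^ (e : ℤ) * w.head), w.toList, w.chain⟩, (i, e, b) :: l₁, l₂, rfl, ?_,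
        ?_, hhead, hj, ?_⟩
      · intro x hx
        rcases List.mem_cons.1 hx with rfl | hx
        · exact hlP _ (by simp) hij
        · exact hl₁ x hx
      · rw [stableProd_cons, hw]
      · rw [stableProd_cons, hprod, hs' i hij]
        simp [HNNExtension.NormalWord.ReducedWord.prod, mul_assoc]

/-- Britton's lemma for multiple HNN extensions: there is a group containing `A` and stable letters
conjugating `S i 1` to `S i (-1)` by the given isomorphisms, in which a pinch-free word
representing an element of `A` contains no stable letters. -/
theorem exists_group_britton [Finite I] (S : I → ℤˣ → Subgroup A)
    (φ : ∀ i, S i 1 ≃* S i (-1)) :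
    ∃ (K : Type) (_ : Group K) (ι : A →* K) (s : I → K), Function.Injective ι ∧
      (∀ i (x : S i 1), s i * ι x = ι (φ i x) * s i) ∧
      ∀ a l, PinchFree S l → stableProd ι s a l ∈ ι.range → l = [] := by
  classical
  have := Fintype.ofFinite I
  suffices h : ∀ J : Finset I, ∃ (K : Type) (_ : Group K) (ι : A →* K) (s : I → K),
      Function.Injective ι ∧ (∀ i ∈ J, ∀ x : S i 1, s i * ι x = ι (φ i x) * s i) ∧
      ∀ a l, (∀ x ∈ l, x.1 ∈ J) → PinchFree S l → stableProd ι s a l ∈ ι.range → l = [] by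
    obtain ⟨K, _, ι, s, h₁, h₂, h₃⟩ := h Finset.univ
    exact ⟨K, _, ι, s, h₁, fun i => h₂ i (Finset.mem_univ i), fun a l => h₃ a l (by simp)⟩
  intro J
  induction J using Finset.induction_on with
  | empty =>
    refine ⟨A, _, MonoidHom.id A, 1, Function.injective_id, by simp, fun a l hl _ _ => ?_⟩
    exact List.eq_nil_iff_forall_not_mem.2 fun x hx => by simpa using hl x hx
  | insert j J hj ih =>
    obtain ⟨K, _, ι, s, hι, hrel, hK⟩ := ih
    let ψ : (S j 1).map ι ≃* (S j (-1)).map ι :=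
      ((S j 1).equivMapOfInjective ι hι).symm.trans
        ((φ j).trans ((S j (-1)).equivMapOfInjective ι hι))
    let s' : I → HNNExtension K ((S j 1).map ι) ((S j (-1)).map ι) ψ :=
      fun i => if i = j then HNNExtension.t else HNNExtension.of (s i)
    have hof : Function.Injective
        (HNNExtension.of : K →* HNNExtension K ((S j 1).map ι) ((S j (-1)).map ι) ψ) :=
      HNNExtension.of_injective ψ
    refine ⟨_, _, (HNNExtension.of (φ := ψ)).comp ι, s', hof.comp hι, ?_, ?_⟩
    · intro i hi x
      by_cases hij : i = j
      · subst hij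
        have h := HNNExtension.t_mul_of (φ := ψ) ((S i 1).equivMapOfInjective ι hι x)
        simpa [s', ψ] using h
      · have h := hrel i ((Finset.mem_insert.1 hi).resolve_left hij) x
        simp only [s', hij, if_false, MonoidHom.comp_apply, ← map_mul, h]
    · intro a l hlJ hl hmem
      obtain ⟨w, l₁, l₂, rfl, hl₁, hw, hhead, -, hprod⟩ :=
        exists_reducedWord_of_pinchFree S j (· ∈ J) ι hι s hK ψ s' (by simp [s'])
          (fun i hi => by simp [s', hi]) l
          (fun x hx hne => (Finset.mem_insert.1 (hlJ x hx)).resolve_left hne) hl a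
      rw [hprod] at hmem
      obtain ⟨c, hc⟩ := hmem
      have hnil := HNNExtension.ReducedWord.toList_eq_nil_of_mem_of_range ψ w ⟨ι c, hc⟩
      have hl₂ : l₂ = [] := by
        cases l₂ with
        | nil => rfl
        | cons z l₂ => simp [hnil] at hhead
      subst hl₂
      have hwc : w.head = ι c := by
        apply hof
        rw [← MonoidHom.comp_apply, hc]
        simp [HNNExtension.NormalWord.ReducedWord.prod, hnil]
      simpa using hK a l₁ hl₁ (by simpa using hl) ⟨c, by rw [← hw, hwc]⟩

end Britton

section Words

variable {β G H : Type*} [Group G] [Group H]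

@[simp]
theorem eval_nil (gen : β → G) : eval gen [] = 1 := rfl

@[simp]
theorem eval_cons (gen : β → G) (x : β ⊕ β) (w : List (β ⊕ β)) :
    eval gen (x :: w) = letterEval gen x * eval gen w := by
  simp [eval]

@[simp]
theorem eval_append (gen : β → G) (w w' : List (β ⊕ β)) :
    eval gen (w ++ w') = eval gen w * eval gen w' := by
  simp [eval]

theorem map_letterEval (f : G →* H) (gen : β → G) (x : β ⊕ β) :
    f (letterEval gen x) = letterEval (f ∘ gen) x := by
  cases x <;> simp [letterEval]

theorem map_eval (f : G →* H) (gen : β → G) (w : List (β ⊕ β)) :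
    f (eval gen w) = eval (f ∘ gen) w := by
  induction w with
  | nil => simp
  | cons x w ih => simp [ih, map_letterEval]

/-- The formal inverse of a word. -/
def invWord (w : List (β ⊕ β)) : List (β ⊕ β) :=
  (w.map Sum.swap).reverse

@[simp]
theorem length_invWord (w : List (β ⊕ β)) : (invWord w).length = w.length := by
  simp [invWord]

@[simp]
theorem eval_invWord (gen : β → G) (w : List (β ⊕ β)) :
    eval gen (invWord w) = (eval gen w)⁻¹ := by
  induction w with
  | nil => simp [invWord]
  | cons x w ih =>
    have hx : letterEval gen x.swap = (letterEval gen x)⁻¹ := by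
      cases x <;> simp [letterEval]
    have : invWord (x :: w) = invWord w ++ [x.swap] := by simp [invWord]
    simp [this, ih, hx]

theorem generates_of_closure_eq_top (gen : β → G) (h : Subgroup.closure (Set.range gen) = ⊤) :
    Generates gen := by
  intro g
  have hg : g ∈ Subgroup.closure (Set.range gen) := h ▸ Subgroup.mem_top g
  induction hg using Subgroup.closure_induction with
  | mem x hx =>
    obtain ⟨b, rfl⟩ := hx
    exact ⟨[Sum.inl b], by simp [letterEval]⟩
  | one => exact ⟨[], rfl⟩
  | mul x y _ _ hx hy =>
    obtain ⟨v, rfl⟩ := hx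
    obtain ⟨w, rfl⟩ := hy
    exact ⟨v ++ w, by simp⟩
  | inv x _ hx =>
    obtain ⟨v, rfl⟩ := hx
    exact ⟨invWord v, by simp⟩

/-- The isomorphism between two free subgroups matching given free bases. -/
theorem exists_mulEquiv_closure_of_lift_injective {κ : Type*} (f f' : κ → G)
    (hf : Function.Injective (FreeGroup.lift f)) (hf' : Function.Injective (FreeGroup.lift f')) :
    ∃ φ : Subgroup.closure (Set.range f) ≃* Subgroup.closure (Set.range f'),
      ∀ j (h : f j ∈ Subgroup.closure (Set.range f)), (φ ⟨f j, h⟩ : G) = f' j := by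
  rw [← FreeGroup.range_lift_eq_closure, ← FreeGroup.range_lift_eq_closure]
  refine ⟨(MonoidHom.ofInjective hf).symm.trans (MonoidHom.ofInjective hf'), fun j hj => ?_⟩
  have h : (MonoidHom.ofInjective hf).symm ⟨f j, hj⟩ = FreeGroup.of j := by
    rw [MulEquiv.symm_apply_eq]
    exact Subtype.ext FreeGroup.lift_apply_of.symm
  rw [MulEquiv.trans_apply, h]
  exact FreeGroup.lift_apply_of

end Words

namespace MHNNData

variable (D : MHNNData)

theorem generates_genA : Generates D.genA :=
  generates_of_closure_eq_top _ (PresentedGroup.closure_range_of D.R)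

theorem generates_genG : Generates D.genG :=
  generates_of_closure_eq_top _ (PresentedGroup.closure_range_of D.relsG)

/-- The free basis of the associated subgroup that the map `a ↦ s_i^e a s_i^{-e}` sends to the
other associated subgroup: the generators `v_{ij}` for `e = 1` and `u_{ij}` for `e = -1`. -/
def basis (i : Fin D.n) (e : ℤˣ) : Fin (D.m i) → D.A :=
  if e = 1 then D.v i else D.u i

/-- The associated subgroup generated by `D.basis i e`. -/
def assoc (i : Fin D.n) (e : ℤˣ) : Subgroup D.A :=
  Subgroup.closure (Set.range (D.basis i e))

/-- The letter `s_i^e`. -/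
def stable (i : Fin D.n) (e : ℤˣ) : (D.X ⊕ Fin D.n) ⊕ (D.X ⊕ Fin D.n) :=
  if e = 1 then Sum.inl (Sum.inr i) else Sum.inr (Sum.inr i)

/-- A word over the generators of the base group, read as a word over the generators of `G`. -/
def baseWord (w : List (D.X ⊕ D.X)) : List ((D.X ⊕ Fin D.n) ⊕ (D.X ⊕ Fin D.n)) :=
  w.map (Sum.map Sum.inl Sum.inl)

@[simp]
theorem length_baseWord (w : List (D.X ⊕ D.X)) : (D.baseWord w).length = w.length := by
  simp [baseWord]

@[simp]
theorem basis_one (i : Fin D.n) : D.basis i 1 = D.v i := rfl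

@[simp]
theorem basis_neg_one (i : Fin D.n) : D.basis i (-1) = D.u i := rfl

/-- The splitting of a word into base group elements separated by stable letters. -/
def splitWord : List ((D.X ⊕ Fin D.n) ⊕ (D.X ⊕ Fin D.n)) →
    D.A × List (Fin D.n × ℤˣ × D.A)
  | [] => (1, [])
  | Sum.inl (Sum.inl x) :: w => (D.genA x * (splitWord w).1, (splitWord w).2)
  | Sum.inr (Sum.inl x) :: w => ((D.genA x)⁻¹ * (splitWord w).1, (splitWord w).2)
  | Sum.inl (Sum.inr i) :: w => (1, (i, 1, (splitWord w).1) :: (splitWord w).2)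
  | Sum.inr (Sum.inr i) :: w => (1, (i, -1, (splitWord w).1) :: (splitWord w).2)

theorem stableProd_splitWord {K : Type} [Group K] (ι : D.A →* K) (s : Fin D.n → K)
    (w : List ((D.X ⊕ Fin D.n) ⊕ (D.X ⊕ Fin D.n))) :
    stableProd ι s (D.splitWord w).1 (D.splitWord w).2 =
      eval (Sum.elim (ι ∘ D.genA) s) w := by
  induction w with
  | nil => simp [splitWord, stableProd]
  | cons x w ih =>
    rcases x with (x | i) | (x | i) <;>
      simp [splitWord, stableProd_cons, letterEval, ← ih] <;>
      simp [stableProd, mul_assoc]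

theorem exists_of_splitWord_eq_nil (w : List ((D.X ⊕ Fin D.n) ⊕ (D.X ⊕ Fin D.n)))
    (h : (D.splitWord w).2 = []) :
    ∃ m, w = D.baseWord m ∧ eval D.genA m = (D.splitWord w).1 := by
  induction w with
  | nil => exact ⟨[], rfl, rfl⟩
  | cons x w ih =>
    rcases x with (x | i) | (x | i) <;> simp only [splitWord, reduceCtorEq] at h
    · obtain ⟨m, rfl, hm⟩ := ih h
      exact ⟨Sum.inl x :: m, rfl, by simp [splitWord, hm, letterEval]⟩
    · obtain ⟨m, rfl, hm⟩ := ih h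
      exact ⟨Sum.inr x :: m, rfl, by simp [splitWord, hm, letterEval]⟩

theorem exists_of_splitWord_eq_cons (w : List ((D.X ⊕ Fin D.n) ⊕ (D.X ⊕ Fin D.n)))
    (i : Fin D.n) (e : ℤˣ) (b : D.A) (l : List (Fin D.n × ℤˣ × D.A))
    (h : (D.splitWord w).2 = (i, e, b) :: l) :
    ∃ m w', w = D.baseWord m ++ D.stable i e :: w' ∧ eval D.genA m = (D.splitWord w).1 ∧
      D.splitWord w' = (b, l) := by
  induction w with
  | nil => simp [splitWord] at h
  | cons x w ih =>
    rcases x with (x | j) | (x | j)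
    · obtain ⟨m, w', rfl, hm, hw'⟩ := ih h
      exact ⟨Sum.inl x :: m, w', rfl, by simp [splitWord, hm, letterEval], hw'⟩
    · simp only [splitWord, List.cons.injEq, Prod.mk.injEq] at h
      obtain ⟨⟨rfl, rfl, rfl⟩, rfl⟩ := h
      exact ⟨[], w, rfl, rfl, rfl⟩
    · obtain ⟨m, w', rfl, hm, hw'⟩ := ih h
      exact ⟨Sum.inr x :: m, w', rfl, by simp [splitWord, hm, letterEval], hw'⟩
    · simp only [splitWord, List.cons.injEq, Prod.mk.injEq] at h
      obtain ⟨⟨rfl, rfl, rfl⟩, rfl⟩ := h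
      exact ⟨[], w, rfl, rfl, rfl⟩

/-- The word `w` contains a subword `s_i^e m s_i^{-e}` with `m` a word over the base generators
representing an element of the associated subgroup `D.assoc i e`. -/
def HasPinch (w : List ((D.X ⊕ Fin D.n) ⊕ (D.X ⊕ Fin D.n))) : Prop :=
  ∃ i e m pre post, eval D.genA m ∈ D.assoc i e ∧
    w = pre ++ (D.stable i e :: (D.baseWord m ++ [D.stable i (-e)])) ++ post

theorem HasPinch.cons {D : MHNNData} {w : List ((D.X ⊕ Fin D.n) ⊕ (D.X ⊕ Fin D.n))}
    (h : D.HasPinch w) (x : (D.X ⊕ Fin D.n) ⊕ (D.X ⊕ Fin D.n)) : D.HasPinch (x :: w) := by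
  obtain ⟨i, e, m, pre, post, hm, rfl⟩ := h
  exact ⟨i, e, m, x :: pre, post, hm, rfl⟩

theorem hasPinch_stable_cons (w : List ((D.X ⊕ Fin D.n) ⊕ (D.X ⊕ Fin D.n)))
    (i : Fin D.n) (e : ℤˣ) (hw : PinchFree D.assoc (D.splitWord w).2)
    (h : ¬ PinchFree D.assoc ((i, e, (D.splitWord w).1) :: (D.splitWord w).2)) :
    D.HasPinch (D.stable i e :: w) := by
  rcases hl : (D.splitWord w).2 with _ | ⟨⟨i', e', b⟩, l⟩
  · rw [hl] at h
    exact absurd (List.isChain_singleton _) h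
  · obtain ⟨m, w', rfl, hm, hw'⟩ := D.exists_of_splitWord_eq_cons w i' e' b l hl
    rw [hl] at h hw
    simp only [PinchFree, List.isChain_cons_cons, not_and] at h
    by_cases hc : i = i' → (D.splitWord (D.baseWord m ++ D.stable i' e' :: w')).1 ∈ D.assoc i e →
        e = e'
    · exact absurd hw (h hc)
    · push Not at hc
      obtain ⟨rfl, hmem, hne⟩ := hc
      have he : e' = -e := by
        rcases Int.units_eq_one_or e with rfl | rfl <;>
          rcases Int.units_eq_one_or e' with rfl | rfl <;> simp_all
      subst he
      exact ⟨i, e, m, [], w', hm ▸ hmem, by simp⟩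

theorem hasPinch_of_not_pinchFree (w : List ((D.X ⊕ Fin D.n) ⊕ (D.X ⊕ Fin D.n)))
    (h : ¬ PinchFree D.assoc (D.splitWord w).2) : D.HasPinch w := by
  induction w with
  | nil => exact absurd List.isChain_nil h
  | cons x w ih =>
    by_cases hw : PinchFree D.assoc (D.splitWord w).2
    · rcases x with (x | i) | (x | i)
      · exact absurd hw h
      · exact D.hasPinch_stable_cons w i 1 hw h
      · exact absurd hw h
      · exact D.hasPinch_stable_cons w i (-1) hw h
    · exact (ih hw).cons x

/-- Britton's lemma for words over the generators of `G`. -/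
theorem britton (hD : D.FreeBases) (w : List ((D.X ⊕ Fin D.n) ⊕ (D.X ⊕ Fin D.n)))
    (hw : eval D.genG w = 1) :
    (∃ m, w = D.baseWord m ∧ eval D.genA m = 1) ∨ D.HasPinch w := by
  by_cases hp : PinchFree D.assoc (D.splitWord w).2
  swap
  · exact Or.inr (D.hasPinch_of_not_pinchFree w hp)
  left
  choose φ hφ using fun i =>
    exists_mulEquiv_closure_of_lift_injective (D.v i) (D.u i) (hD i).2 (hD i).1
  obtain ⟨K, _, ι, s, hι, hrel, hK⟩ := exists_group_britton D.assoc φ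
  have hlift : ∀ r, FreeGroup.lift (Sum.elim (ι ∘ D.genA) s) (FreeGroup.map Sum.inl r) =
      ι (D.projA r) := by
    intro r
    have : (FreeGroup.lift (Sum.elim (ι ∘ D.genA) s)).comp (FreeGroup.map Sum.inl) =
        ι.comp D.projA := by
      ext x
      simp only [MonoidHom.comp_apply, FreeGroup.map.of, FreeGroup.lift_apply_of, Sum.elim_inl]
      rfl
    exact DFunLike.congr_fun this r
  have hrels : ∀ r ∈ D.relsG, FreeGroup.lift (Sum.elim (ι ∘ D.genA) s) r = 1 := by
    rintro r (⟨r, hr, rfl⟩ | ⟨i, j, rfl⟩)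
    · rw [hlift]
      have : D.projA r = 1 := PresentedGroup.one_of_mem hr
      rw [this, map_one]
    · have hv : D.v i j ∈ D.assoc i 1 := Subgroup.subset_closure ⟨j, rfl⟩
      have h : s i * ι (D.v i j) = ι (D.u i j) * s i :=
        (hrel i ⟨D.v i j, hv⟩).trans (congrArg (fun a => ι a * s i) (hφ i j hv))
      simp only [map_mul, map_inv, hlift, FreeGroup.lift_apply_of, Sum.elim_inr]
      change (s i)⁻¹ * ι (D.u i j) * s i * (ι (D.v i j))⁻¹ = 1
      rw [mul_assoc (s i)⁻¹, ← h]
      simp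
  let f : D.G →* K := PresentedGroup.toGroup hrels
  have hf : f ∘ D.genG = Sum.elim (ι ∘ D.genA) s := by
    ext x
    exact PresentedGroup.toGroup.of hrels
  have hprod : stableProd ι s (D.splitWord w).1 (D.splitWord w).2 = 1 := by
    rw [stableProd_splitWord, ← hf, ← map_eval, hw, map_one]
  have hnil := hK _ _ hp (hprod ▸ one_mem _)
  obtain ⟨m, rfl, hm⟩ := D.exists_of_splitWord_eq_nil w hnil
  refine ⟨m, rfl, hm.trans (hι ?_)⟩
  simpa [stableProd, hnil] using hprod

end MHNNData

section Metric

variable {β G : Type*} [Group G] {gen : β → G}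

theorem wlen_eval_le (w : List (β ⊕ β)) : wlen gen (eval gen w) ≤ w.length :=
  Nat.sInf_le ⟨w, rfl, rfl⟩

theorem Generates.exists_eval_eq (hgen : Generates gen) (g : G) :
    ∃ w, eval gen w = g ∧ w.length = wlen gen g := by
  obtain ⟨w, hw⟩ := hgen g
  exact Nat.sInf_mem (s := {n | ∃ w : List (β ⊕ β), eval gen w = g ∧ w.length = n})
    ⟨w.length, w, hw, rfl⟩

@[simp]
theorem wlen_one : wlen gen (1 : G) = 0 := by
  simpa using wlen_eval_le (gen := gen) []

theorem Generates.wlen_mul_le (hgen : Generates gen) (g h : G) :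
    wlen gen (g * h) ≤ wlen gen g + wlen gen h := by
  obtain ⟨v, rfl, hv⟩ := hgen.exists_eval_eq g
  obtain ⟨w, rfl, hw⟩ := hgen.exists_eval_eq h
  rw [← eval_append, ← hv, ← hw, ← List.length_append]
  exact wlen_eval_le _

theorem Generates.wlen_inv (hgen : Generates gen) (g : G) : wlen gen g⁻¹ = wlen gen g := by
  have h : ∀ g : G, wlen gen g⁻¹ ≤ wlen gen g := by
    intro g
    obtain ⟨v, rfl, hv⟩ := hgen.exists_eval_eq g
    rw [← hv, ← eval_invWord, ← length_invWord v]
    exact wlen_eval_le _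
  exact (h g).antisymm (by simpa using h g⁻¹)

theorem Generates.wlen_inv_mul_comm (hgen : Generates gen) (g h : G) :
    wlen gen (g⁻¹ * h) = wlen gen (h⁻¹ * g) := by
  rw [← hgen.wlen_inv (g⁻¹ * h)]
  simp

theorem Generates.wlen_le_add (hgen : Generates gen) (g h : G) :
    wlen gen h ≤ wlen gen g + wlen gen (g⁻¹ * h) := by
  simpa using hgen.wlen_mul_le g (g⁻¹ * h)

theorem IsGeodesic.of_append (hgen : Generates gen) {u v w : List (β ⊕ β)}
    (h : IsGeodesic gen (u ++ v ++ w)) : IsGeodesic gen v := by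
  refine le_antisymm ?_ (wlen_eval_le v)
  have h₁ := hgen.wlen_mul_le (eval gen u * eval gen v) (eval gen w)
  have h₂ := hgen.wlen_mul_le (eval gen u) (eval gen v)
  have h₃ := wlen_eval_le (gen := gen) u
  have h₄ := wlen_eval_le (gen := gen) w
  simp only [IsGeodesic, List.length_append, eval_append] at h
  omega

theorem wlen_pos_inv_mul_pos_le (w : List (β ⊕ β)) {s t : ℕ} (hst : s ≤ t) :
    wlen gen ((pos gen w s)⁻¹ * pos gen w t) ≤ min t w.length - s := by
  have h : pos gen w t = pos gen w s * eval gen ((w.take t).drop s) := by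
    have := List.take_append_drop s (w.take t)
    rw [List.take_take, min_eq_left hst] at this
    rw [pos, pos, ← eval_append, this]
  rw [h, inv_mul_cancel_left]
  simpa using wlen_eval_le (gen := gen) ((w.take t).drop s)

@[simp]
theorem pos_zero (w : List (β ⊕ β)) : pos gen w 0 = 1 := rfl

theorem pos_of_length_le {w : List (β ⊕ β)} {t : ℕ} (h : w.length ≤ t) :
    pos gen w t = eval gen w := by
  rw [pos, List.take_of_length_le h]

/-- The elements `x` and `y` are joined by a path of length at most `L` inside the ball of
radius `N`. -/
def BallPath (gen : β → G) (N L : ℕ) (x y : G) : Prop :=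
  ∃ w : List (β ⊕ β), x * eval gen w = y ∧ w.length ≤ L ∧ PathInBall gen N x w

theorem BallPath.mono {N L L' : ℕ} {x y : G} (h : BallPath gen N L x y) (hL : L ≤ L') :
    BallPath gen N L' x y := by
  obtain ⟨w, hw, hwL, hwN⟩ := h
  exact ⟨w, hw, hwL.trans hL, hwN⟩

theorem BallPath.trans {N L L' : ℕ} {x y z : G} (h : BallPath gen N L x y)
    (h' : BallPath gen N L' y z) : BallPath gen N (L + L') x z := by
  obtain ⟨w, rfl, hwL, hwN⟩ := h
  obtain ⟨w', rfl, hwL', hwN'⟩ := h'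
  refine ⟨w ++ w', by simp [mul_assoc], by simp; omega, fun t => ?_⟩
  have hpos : pos gen (w ++ w') t = pos gen w t * pos gen w' (t - w.length) := by
    simp [pos, List.take_append]
  rw [hpos]
  rcases le_total t w.length with ht | ht
  · simpa [Nat.sub_eq_zero_of_le ht] using hwN t
  · simpa [pos_of_length_le ht, mul_assoc] using hwN' (t - w.length)

/-- A geodesic whose endpoints are deep enough in a ball relative to its length stays in the
ball. -/
theorem Generates.ballPath (hgen : Generates gen) {N d : ℕ} {x y : G}
    (hd : wlen gen (x⁻¹ * y) ≤ d) (h : wlen gen x + wlen gen y + d ≤ 2 * N + 1) :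
    BallPath gen N d x y := by
  obtain ⟨w, hw, hwl⟩ := hgen.exists_eval_eq (x⁻¹ * y)
  refine ⟨w, by simp [hw], hwl ▸ hd, fun t => ?_⟩
  have hy : x * eval gen w = y := by simp [hw]
  have h₁ := hgen.wlen_le_add x (x * pos gen w t)
  have h₂ := hgen.wlen_le_add y (x * pos gen w t)
  have h₃ := wlen_eval_le (gen := gen) (w.take t)
  have h₄ := wlen_pos_inv_mul_pos_le (gen := gen) w (le_max_left t w.length)
  rw [pos_of_length_le (le_max_right _ _)] at h₄
  rw [hgen.wlen_inv_mul_comm, ← hy] at h₂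
  simp only [mul_inv_rev, mul_assoc, inv_mul_cancel_left] at h₁ h₂
  simp only [List.length_take] at h₃
  rw [hy] at h₂
  change wlen gen (pos gen w t) ≤ _ at h₃
  omega

end Metric

namespace MHNNData

variable (D : MHNNData)

/-- The canonical homomorphism from the base group to the multiple HNN extension. -/
def incl : D.A →* D.G :=
  PresentedGroup.toGroup (rels := D.R) (f := D.genG ∘ Sum.inl) (by
    intro r hr
    have h : FreeGroup.lift (D.genG ∘ Sum.inl) =
        (PresentedGroup.mk D.relsG).comp (FreeGroup.map Sum.inl) := by
      ext x
      rw [FreeGroup.lift_apply_of]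
      rfl
    rw [h]
    exact PresentedGroup.one_of_mem (Or.inl ⟨r, hr, rfl⟩))

theorem incl_genA (x : D.X) : D.incl (D.genA x) = D.genG (Sum.inl x) :=
  PresentedGroup.toGroup.of _

theorem incl_projA (r : FreeGroup D.X) :
    D.incl (D.projA r) = PresentedGroup.mk D.relsG (FreeGroup.map Sum.inl r) := by
  have : D.incl.comp D.projA = (PresentedGroup.mk D.relsG).comp (FreeGroup.map Sum.inl) := by
    ext x
    exact D.incl_genA x
  exact DFunLike.congr_fun this r

theorem eval_baseWord (w : List (D.X ⊕ D.X)) :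
    eval D.genG (D.baseWord w) = D.incl (eval D.genA w) := by
  induction w with
  | nil => simp [baseWord]
  | cons x w ih =>
    rw [baseWord, List.map_cons, eval_cons, ← baseWord, ih, eval_cons, map_mul]
    cases x <;> simp [letterEval, incl_genA]

theorem wlen_incl_le (a : D.A) : wlen D.genG (D.incl a) ≤ wlen D.genA a := by
  obtain ⟨w, rfl, hw⟩ := D.generates_genA.exists_eval_eq a
  rw [← hw, ← eval_baseWord, ← D.length_baseWord w]
  exact wlen_eval_le _

theorem isGeodesic_of_baseWord {w : List (D.X ⊕ D.X)} (h : IsGeodesic D.genG (D.baseWord w)) :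
    IsGeodesic D.genA w := by
  refine le_antisymm ?_ (wlen_eval_le w)
  rw [IsGeodesic, length_baseWord, eval_baseWord] at h
  exact h.trans_le (D.wlen_incl_le _)

theorem letterEval_stable_neg (i : Fin D.n) (e : ℤˣ) :
    letterEval D.genG (D.stable i (-e)) = (letterEval D.genG (D.stable i e))⁻¹ := by
  rcases Int.units_eq_one_or e with rfl | rfl <;> simp [stable, letterEval]

/-- Conjugation by the stable letter `s_i^e` carries one associated subgroup to the other, matching
the given bases. -/
theorem stable_conj_basis (i : Fin D.n) (e : ℤˣ) (j : Fin (D.m i)) :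
    letterEval D.genG (D.stable i e) * D.incl (D.basis i e j) *
      (letterEval D.genG (D.stable i e))⁻¹ = D.incl (D.basis i (-e) j) := by
  have h : (D.genG (Sum.inr i))⁻¹ * D.incl (D.u i j) * D.genG (Sum.inr i) *
      (D.incl (D.v i j))⁻¹ = 1 := by
    have := PresentedGroup.one_of_mem (rels := D.relsG) (Or.inr ⟨i, j, rfl⟩)
    rw [u, v, incl_projA, incl_projA]
    simp only [map_mul, map_inv] at this
    exact this
  rw [mul_inv_eq_one] at h
  rcases Int.units_eq_one_or e with rfl | rfl
  · simp [stable, letterEval, ← h, mul_assoc]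
  · simp [stable, letterEval, ← h, mul_assoc]

theorem wlen_basis_neg (h : D.StripEquidistant) (i : Fin D.n) (e : ℤˣ) (j : Fin (D.m i)) :
    wlen D.genA (D.basis i (-e) j) = wlen D.genA (D.basis i e j) := by
  rcases Int.units_eq_one_or e with rfl | rfl
  · simp [h i j]
  · simp [h i j]

/-- A word over the base generators that is the label of one edge of a strip. -/
def IsStripEdge (i : Fin D.n) (e : ℤˣ) (c : List (D.X ⊕ D.X)) : Prop :=
  IsGeodesic D.genA c ∧ ∃ j, eval D.genA c = D.basis i e j ∨ eval D.genA c = (D.basis i e j)⁻¹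

theorem exists_stripEdges (h : D.TotallyGeodesic) (i : Fin D.n) (e : ℤˣ) {w : List (D.X ⊕ D.X)}
    (hw : IsGeodesic D.genA w) (hmem : eval D.genA w ∈ D.assoc i e) :
    ∃ ps : List (List (D.X ⊕ D.X)), w = ps.flatten ∧ ∀ c ∈ ps, c ≠ [] ∧ D.IsStripEdge i e c := by
  have htg : TGConcat D.genA (Set.range (D.basis i e)) := by
    rcases Int.units_eq_one_or e with rfl | rfl
    · exact (h i).2.1
    · exact (h i).1.1
  obtain ⟨ps, rfl, hps⟩ := htg w hw hmem
  refine ⟨ps.filter (fun c => !c.isEmpty), List.flatten_filter_not_isEmpty.symm, fun c hc => ?_⟩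
  rw [List.mem_filter] at hc
  obtain ⟨hgeo, g, ⟨j, rfl⟩, hj⟩ := hps c hc.1
  exact ⟨by simpa using hc.2, hgeo, j, hj⟩

theorem IsStripEdge.exists_length_eq {D : MHNNData} {i : Fin D.n} {e : ℤˣ}
    {c : List (D.X ⊕ D.X)} (hc : D.IsStripEdge i e c) :
    ∃ j, c.length = wlen D.genA (D.basis i e j) := by
  obtain ⟨hgeo, j, hj⟩ := hc
  refine ⟨j, hgeo.trans ?_⟩
  rcases hj with hj | hj
  · rw [hj]
  · rw [hj, D.generates_genA.wlen_inv]

/-- The top side of a strip edge is at most as long as its bottom side. -/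
theorem IsStripEdge.wlen_conj_le {D : MHNNData} (hD : D.StripEquidistant) {i : Fin D.n} {e : ℤˣ}
    {c : List (D.X ⊕ D.X)} (hc : D.IsStripEdge i e c) :
    wlen D.genG (letterEval D.genG (D.stable i e) * D.incl (eval D.genA c) *
      (letterEval D.genG (D.stable i e))⁻¹) ≤ c.length := by
  obtain ⟨hgeo, j, hj⟩ := hc
  have hb : wlen D.genG (D.incl (D.basis i (-e) j)) ≤ wlen D.genA (D.basis i e j) :=
    (D.wlen_incl_le _).trans_eq (D.wlen_basis_neg hD i e j)
  rw [hgeo]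
  rcases hj with hj | hj
  · rwa [hj, stable_conj_basis]
  · rw [hj, D.generates_genA.wlen_inv, map_inv, ← conj_inv, stable_conj_basis,
      D.generates_genG.wlen_inv]
    exact hb

theorem wlen_conj_flatten_le (hD : D.StripEquidistant) {i : Fin D.n} {e : ℤˣ}
    {ps : List (List (D.X ⊕ D.X))} (hps : ∀ c ∈ ps, D.IsStripEdge i e c) :
    wlen D.genG (letterEval D.genG (D.stable i e) * D.incl (eval D.genA ps.flatten) *
      (letterEval D.genG (D.stable i e))⁻¹) ≤ ps.flatten.length := by
  induction ps with
  | nil => simp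
  | cons c ps ih =>
    have h₁ := (hps c (by simp)).wlen_conj_le hD
    have h₂ := ih fun c hc => hps c (List.mem_cons_of_mem _ hc)
    rw [List.flatten_cons, eval_append, map_mul, List.length_append, ← conj_mul]
    exact (D.generates_genG.wlen_mul_le _ _).trans (add_le_add h₁ h₂)

theorem not_hasPinch_of_isGeodesic (hD : D.IsIsometric)
    {w : List ((D.X ⊕ Fin D.n) ⊕ (D.X ⊕ Fin D.n))} (hw : IsGeodesic D.genG w) :
    ¬ D.HasPinch w := by
  rintro ⟨i, e, m, pre, post, hm, rfl⟩
  have hgeo := hw.of_append D.generates_genG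
  have hbase : IsGeodesic D.genG (D.baseWord m) :=
    IsGeodesic.of_append D.generates_genG (u := [D.stable i e]) hgeo
  obtain ⟨ps, rfl, hps⟩ := D.exists_stripEdges hD.2.1 i e (D.isGeodesic_of_baseWord hbase) hm
  have h := D.wlen_conj_flatten_le hD.2.2 fun c hc => (hps c hc).2
  simp only [IsGeodesic, List.length_cons, List.length_append, length_baseWord, eval_cons,
    eval_append, eval_baseWord, letterEval_stable_neg, eval_nil, mul_one, ← mul_assoc,
    List.length_nil] at hgeo
  omega

end MHNNData

section FellowTravel

variable {β G : Type*} [Group G] {gen : β → G}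

/-- Let `P` be a path of length `a + b` whose vertices before and after time `a` lie in the ball of
radius `N`, and suppose that `P` is synchronously `2h`-fellow traveled by a path `E` with the same
endpoints and of length `L < a + b`. Then one can go around the vertex `P a` inside the ball. -/
theorem Generates.ballPath_of_fellowTravel (hgen : Generates gen) {N h a b L : ℕ} {P E : ℕ → G}
    (ha : 1 ≤ a) (hb : 1 ≤ b) (hL : L < a + b)
    (hP : ∀ s t, s ≤ t → wlen gen ((P s)⁻¹ * P t) ≤ t - s)
    (hE : ∀ s t, s ≤ t → wlen gen ((E s)⁻¹ * E t) ≤ min t L - s)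
    (hstart : E 0 = P 0) (hend : ∀ t, L ≤ t → E t = P (a + b))
    (hfellow : ∀ t, wlen gen ((P t)⁻¹ * E t) ≤ 2 * h)
    (hP₀ : wlen gen (P 0) + a ≤ N + 1) (hP₁ : wlen gen (P (a + b)) + b ≤ N + 1) :
    BallPath gen N (12 * h + 2) (P (a - 1)) (P (a + 1)) := by
  have hPl : ∀ t, wlen gen (P t) ≤ wlen gen (P 0) + t := fun t =>
    (hgen.wlen_le_add (P 0) (P t)).trans (by have := hP 0 t t.zero_le; omega)
  have hPr : ∀ t ≤ a + b, wlen gen (P t) ≤ wlen gen (P (a + b)) + (a + b - t) := fun t ht =>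
    (hgen.wlen_le_add (P (a + b)) (P t)).trans (by
      rw [hgen.wlen_inv_mul_comm]; have := hP t _ ht; omega)
  have hEl : ∀ t, wlen gen (E t) ≤ wlen gen (P 0) + t := fun t =>
    (hgen.wlen_le_add (E 0) (E t)).trans (by
      have := hE 0 t t.zero_le; rw [hstart] at this ⊢; omega)
  have hEr : ∀ t, wlen gen (E t) ≤ wlen gen (P (a + b)) + (L - t) := by
    intro t
    have h₁ := hgen.wlen_le_add (E (max t L)) (E t)
    have h₂ := hE t (max t L) (le_max_left _ _)
    rw [hgen.wlen_inv_mul_comm] at h₁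
    rw [hend _ (le_max_right _ _)] at h₁ h₂
    omega
  obtain ⟨t₀, ht₀, ht₀', hleft⟩ : ∃ t ≤ a - 1, a - 1 ≤ t + h ∧
      BallPath gen N (3 * h) (P (a - 1)) (E t) := by
    by_cases hah : h ≤ a - 1
    · refine ⟨a - 1 - h, by omega, by omega, ?_⟩
      have h₁ := hPl (a - 1)
      have h₂ := hPl (a - 1 - h)
      have h₃ := hEl (a - 1 - h)
      have h₄ := hP (a - 1 - h) (a - 1) (by omega)
      rw [hgen.wlen_inv_mul_comm] at h₄
      refine ((hgen.ballPath (d := h) (h₄.trans (by omega)) (by omega)).trans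
        (hgen.ballPath (d := 2 * h) (hfellow _) (by omega))).mono (by omega)
    · refine ⟨0, by omega, by omega, ?_⟩
      have h₁ := hPl (a - 1)
      have h₂ := hP 0 (a - 1) (by omega)
      rw [hgen.wlen_inv_mul_comm] at h₂
      rw [hstart]
      exact (hgen.ballPath h₂ (by omega)).mono (by omega)
  obtain ⟨t₁, ht₁, ht₁', hright⟩ : ∃ t, a + 1 ≤ t ∧ t ≤ a + 1 + h ∧
      BallPath gen N (3 * h) (E t) (P (a + 1)) := by
    have h₁ := hPr (a + 1) (by omega)
    by_cases hbh : h + 1 < b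
    · refine ⟨a + 1 + h, by omega, by omega, ?_⟩
      have h₂ := hPr (a + 1 + h) (by omega)
      have h₃ := hEr (a + 1 + h)
      have h₄ := hP (a + 1) (a + 1 + h) (by omega)
      have h₅ := hfellow (a + 1 + h)
      rw [hgen.wlen_inv_mul_comm] at h₄ h₅
      exact ((hgen.ballPath h₅ (by omega)).trans
        (hgen.ballPath (d := h) (h₄.trans (by omega)) (by omega))).mono (by omega)
    · refine ⟨a + b, by omega, by omega, ?_⟩
      have h₂ := hP (a + 1) (a + b) (by omega)
      rw [hgen.wlen_inv_mul_comm] at h₂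
      rw [hend _ hL.le]
      exact (hgen.ballPath h₂ (by omega)).mono (by omega)
  have h₁ := hEl t₀
  have h₂ := hEr t₀
  have h₃ := hEr t₁
  have hmid := hgen.ballPath (N := N) (hE t₀ t₁ (by omega)) (by omega)
  exact ((hleft.trans hmid).trans hright).mono (by omega)

end FellowTravel

namespace MHNNData

variable (D : MHNNData)

theorem ballPath_of_not_isGeodesic {k : ℕ} (hk : Even k) (hfftp : SynchFFTP D.genA k) {N a : ℕ}
    {q : D.G} {w : List (D.X ⊕ D.X)} (hw : ¬ IsGeodesic D.genA w) (ha : 1 ≤ a)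
    (haw : a + 1 ≤ w.length) (hq : wlen D.genG q + a ≤ N + 1)
    (hq' : wlen D.genG (q * D.incl (eval D.genA w)) + (w.length - a) ≤ N + 1) :
    BallPath D.genG N (6 * k + 2) (q * D.incl (pos D.genA w (a - 1)))
      (q * D.incl (pos D.genA w (a + 1))) := by
  obtain ⟨h, rfl⟩ := hk.two_dvd
  obtain ⟨w', heval, hlen, hfellow⟩ := hfftp w hw
  obtain ⟨b, hb⟩ := Nat.exists_eq_add_of_le (show a ≤ w.length by omega)
  have hincl : ∀ x y : D.A, wlen D.genG ((q * D.incl x)⁻¹ * (q * D.incl y)) ≤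
      wlen D.genA (x⁻¹ * y) := by
    intro x y
    refine le_of_eq_of_le ?_ (D.wlen_incl_le (x⁻¹ * y))
    simp [mul_assoc]
  refine (D.generates_genG.ballPath_of_fellowTravel (N := N) (h := h) (a := a) (b := b)
    (L := w'.length) (P := fun t => q * D.incl (pos D.genA w t))
    (E := fun t => q * D.incl (pos D.genA w' t)) ha (by omega) (by omega) ?_ ?_ (by simp) ?_ ?_
    (by simpa using hq) ?_).mono (by omega)
  · intro s t hst
    have := wlen_pos_inv_mul_pos_le (gen := D.genA) w hst
    exact (hincl _ _).trans (by omega)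
  · intro s t hst
    exact (hincl _ _).trans (wlen_pos_inv_mul_pos_le w' hst)
  · intro t ht
    simp only [pos_of_length_le ht, pos_of_length_le hb.le, heval]
  · intro t
    exact (hincl _ _).trans (hfellow t)
  · simp only [pos_of_length_le hb.le]
    omega

end MHNNData

theorem exists_append_flatten_length {α : Type*} (ps : List (List α)) (a : ℕ)
    (ha : a ≤ ps.flatten.length) :
    (∃ ps₁ ps₂, ps = ps₁ ++ ps₂ ∧ ps₁.flatten.length = a) ∨
      ∃ ps₁ c ps₂, ps = ps₁ ++ c :: ps₂ ∧ ps₁.flatten.length < a ∧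
        a < ps₁.flatten.length + c.length := by
  induction ps generalizing a with
  | nil => exact Or.inl ⟨[], [], rfl, by simp at ha ⊢; omega⟩
  | cons c ps ih =>
    rcases Nat.eq_zero_or_pos a with rfl | hpos
    · exact Or.inl ⟨[], c :: ps, rfl, rfl⟩
    rcases lt_or_ge a c.length with hac | hac
    · exact Or.inr ⟨[], c, ps, rfl, by simpa using hpos, by simpa using hac⟩
    rw [List.flatten_cons, List.length_append] at ha
    rcases ih (a - c.length) (by omega) with ⟨ps₁, ps₂, rfl, h⟩ | ⟨ps₁, d, ps₂, rfl, h₁, h₂⟩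
    · exact Or.inl ⟨c :: ps₁, ps₂, rfl, by simp only [List.flatten_cons, List.length_append]; omega⟩
    · refine Or.inr ⟨c :: ps₁, d, ps₂, rfl, ?_⟩
      simp only [List.flatten_cons, List.length_append]
      omega

namespace MHNNData

variable (D : MHNNData)

/-- If the top side of a strip, starting at `z`, lies deep enough in the ball of radius `N`, then it
can be used to go around the point at distance `a` along the bottom side, which is labelled by
`ps.flatten`. -/
theorem ballPath_of_strip (hD : D.StripEquidistant) {M : ℕ}
    (hM : ∀ i e j, wlen D.genA (D.basis i e j) ≤ M) {i : Fin D.n} {e : ℤˣ}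
    {ps : List (List (D.X ⊕ D.X))} (hps : ∀ c ∈ ps, c ≠ [] ∧ D.IsStripEdge i e c) {N a : ℕ}
    {z σ g g' : D.G} (hσ : σ = letterEval D.genG (D.stable i e)) (ha : a ≤ ps.flatten.length)
    (hz : wlen D.genG z + a ≤ N)
    (hz' : wlen D.genG (z * (σ * D.incl (eval D.genA ps.flatten) * σ⁻¹)) +
      (ps.flatten.length - a) ≤ N)
    (hgN : wlen D.genG g ≤ N) (hgN' : wlen D.genG g' ≤ N)
    (hg : a = 0 ∧ g = z ∨ 1 ≤ a ∧ g = z * σ * D.incl (pos D.genA ps.flatten (a - 1)))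
    (hg' : a = ps.flatten.length ∧ g' = z * (σ * D.incl (eval D.genA ps.flatten) * σ⁻¹) ∨
      a + 1 ≤ ps.flatten.length ∧ g' = z * σ * D.incl (pos D.genA ps.flatten (a + 1))) :
    BallPath D.genG N (4 * M) g g' := by
  have hgen := D.generates_genG
  set B : List (List (D.X ⊕ D.X)) → D.G :=
    fun qs => z * (σ * D.incl (eval D.genA qs.flatten) * σ⁻¹) with hB
  have hBnil : B [] = z := by simp [hB]
  have hBB : ∀ qs rs, (∀ c ∈ rs, c ∈ ps) →
      wlen D.genG ((B qs)⁻¹ * B (qs ++ rs)) ≤ rs.flatten.length := by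
    intro qs rs hrs
    have h := D.wlen_conj_flatten_le hD fun c hc => (hps c (hrs c hc)).2
    rw [← hσ] at h
    refine le_of_eq_of_le (congrArg _ ?_) h
    simp only [hB, List.flatten_append, eval_append, map_mul]
    group
  have hBl : ∀ qs rs, ps = qs ++ rs → wlen D.genG (B qs) + a ≤ N + qs.flatten.length := by
    rintro qs rs rfl
    have h₁ := hgen.wlen_le_add (B []) (B qs)
    have h₂ := hBB [] qs fun c hc => List.mem_append_left _ hc
    rw [List.nil_append] at h₂
    rw [hBnil] at h₁ h₂
    omega
  have hBr : ∀ qs rs, ps = qs ++ rs →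
      wlen D.genG (B qs) + ps.flatten.length ≤ N + a + rs.flatten.length := by
    rintro qs rs rfl
    have h₁ := hgen.wlen_le_add (B (qs ++ rs)) (B qs)
    have h₂ := hBB qs rs fun c hc => List.mem_append_right _ hc
    rw [hgen.wlen_inv_mul_comm] at h₂
    change wlen D.genG (B (qs ++ rs)) + _ ≤ N at hz'
    omega
  have hTB : ∀ qs rs t, ps = qs ++ rs → t ≤ ps.flatten.length →
      wlen D.genG ((z * σ * D.incl (pos D.genA ps.flatten t))⁻¹ * B qs) ≤
        max t qs.flatten.length - min t qs.flatten.length + 1 := by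
    rintro qs rs t rfl ht
    have hσ' : wlen D.genG σ⁻¹ ≤ 1 := by
      rw [hgen.wlen_inv, hσ]
      simpa using wlen_eval_le (gen := D.genG) [D.stable i e]
    have hqs : eval D.genA qs.flatten = pos D.genA (qs ++ rs).flatten qs.flatten.length := by
      simp [pos]
    have h₁ : wlen D.genA ((pos D.genA (qs ++ rs).flatten t)⁻¹ * eval D.genA qs.flatten) ≤
        max t qs.flatten.length - min t qs.flatten.length := by
      rw [hqs]
      rcases le_total t qs.flatten.length with htq | htq
      · exact (wlen_pos_inv_mul_pos_le _ htq).trans (by omega)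
      · rw [D.generates_genA.wlen_inv_mul_comm]
        exact (wlen_pos_inv_mul_pos_le _ htq).trans (by omega)
    have h₂ := hgen.wlen_mul_le (D.incl ((pos D.genA (qs ++ rs).flatten t)⁻¹ *
      eval D.genA qs.flatten)) σ⁻¹
    have h₃ := (D.wlen_incl_le _).trans h₁
    refine le_trans (le_of_eq_of_le (congrArg _ ?_) h₂) (by omega)
    simp only [hB, map_mul, map_inv]
    group
  have hcM : ∀ c ∈ ps, 0 < c.length ∧ c.length ≤ M := by
    intro c hc
    obtain ⟨j, hj⟩ := (hps c hc).2.exists_length_eq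
    exact ⟨List.length_pos_iff.2 (hps c hc).1, hj.trans_le (hM i e j)⟩
  rcases exists_append_flatten_length ps a ha with ⟨ps₁, ps₂, hsplit, hps₁⟩ |
    ⟨ps₁, c, ps₂, hsplit, hlt, hlt'⟩
  · have hlen : ps.flatten.length = ps₁.flatten.length + ps₂.flatten.length := by simp [hsplit]
    have hmid := hBl ps₁ ps₂ hsplit
    have hleft : BallPath D.genG N (2 * M) g (B ps₁) := by
      rcases hg with ⟨ha₀, rfl⟩ | ⟨ha₁, rfl⟩
      · have : B ps₁ = g := by
          rw [← hBnil]
          simp only [hB, List.eq_nil_of_length_eq_zero (hps₁.trans ha₀), List.flatten_nil]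
        rw [this]
        exact (hgen.ballPath (d := 0) (by simp) (by omega)).mono (by omega)
      · rcases List.eq_nil_or_concat ps₁ with rfl | ⟨ps₀, c, rfl⟩
        · simp at hps₁
          omega
        rw [List.concat_eq_append] at *
        have hc := hcM c (by simp [hsplit])
        simp only [List.flatten_append, List.flatten_singleton, List.length_append]
          at hps₁ hlen hmid
        rw [List.append_assoc] at hsplit
        have h₁ := hBl ps₀ _ hsplit
        have h₂ := hTB ps₀ _ (a - 1) hsplit (by omega)
        have h₃ := hBB ps₀ [c] (by simp [hsplit])
        rw [List.flatten_singleton] at h₃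
        exact ((hgen.ballPath (d := c.length) (h₂.trans (by omega)) (by omega)).trans
          (hgen.ballPath h₃ (by omega))).mono (by omega)
    have hright : BallPath D.genG N (2 * M) (B ps₁) g' := by
      rcases ps₂ with _ | ⟨c, ps₂⟩
      · rw [List.append_nil] at hsplit
        have : B ps₁ = g' := by
          rcases hg' with ⟨-, rfl⟩ | ⟨ha₁, -⟩
          · simp only [hB, hsplit]
          · simp only [List.flatten_nil, List.length_nil] at hlen
            omega
        rw [this]
        exact (hgen.ballPath (d := 0) (by simp) (by omega)).mono (by omega)
      · have hc := hcM c (by simp [hsplit])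
        simp only [List.flatten_cons, List.length_append] at hlen
        obtain ⟨ha₁, rfl⟩ := hg'.resolve_left fun h => by omega
        rw [List.append_cons] at hsplit
        have h₁ := hBr (ps₁ ++ [c]) _ hsplit
        have h₂ := hTB (ps₁ ++ [c]) _ (a + 1) hsplit (by omega)
        have h₃ := hBB ps₁ [c] (by simp [hsplit])
        rw [hgen.wlen_inv_mul_comm] at h₂
        simp only [List.flatten_append, List.flatten_singleton, List.length_append] at h₂ h₃
        exact ((hgen.ballPath h₃ (by omega)).trans
          (hgen.ballPath (d := c.length) (h₂.trans (by omega)) (by omega))).mono (by omega)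
    exact (hleft.trans hright).mono (by omega)
  · have hlen : ps.flatten.length =
        ps₁.flatten.length + (c.length + ps₂.flatten.length) := by simp [hsplit]
    have hc := hcM c (by simp [hsplit])
    obtain ⟨-, rfl⟩ := hg.resolve_left fun h => by omega
    obtain ⟨-, rfl⟩ := hg'.resolve_left fun h => by omega
    have h₁ := hBl ps₁ _ hsplit
    have h₂ := hTB ps₁ _ (a - 1) hsplit (by omega)
    have h₃ := hBB ps₁ [c] (by simp [hsplit])
    rw [List.append_cons] at hsplit
    have h₄ := hBr (ps₁ ++ [c]) _ hsplit
    have h₅ := hTB (ps₁ ++ [c]) _ (a + 1) hsplit (by omega)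
    rw [hgen.wlen_inv_mul_comm] at h₅
    simp only [List.flatten_append, List.flatten_singleton, List.length_append] at h₃ h₅
    exact (((hgen.ballPath (d := a - ps₁.flatten.length) (h₂.trans (by omega)) (by omega)).trans
      (hgen.ballPath h₃ (by omega))).trans (hgen.ballPath
        (d := ps₁.flatten.length + c.length - a) (h₅.trans (by omega)) (by omega))).mono
          (by omega)

end MHNNData

namespace MHNNData

variable (D : MHNNData)

theorem pos_baseWord (w : List (D.X ⊕ D.X)) (t : ℕ) :
    pos D.genG (D.baseWord w) t = D.incl (pos D.genA w t) := by
  rw [pos, baseWord, ← List.map_take, ← baseWord, eval_baseWord, pos]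

/-- In a bigon formed by two geodesics of length `N + 1`, one can go around the vertex opposite to
the base point inside the ball of radius `N`. -/
theorem ballPath_of_bigon (hD : D.IsIsometric) {k : ℕ} (hk : Even k) (hfftp : SynchFFTP D.genA k)
    {M : ℕ} (hM : ∀ i e j, wlen D.genA (D.basis i e j) ≤ M) {N : ℕ}
    {α δ : List ((D.X ⊕ Fin D.n) ⊕ (D.X ⊕ Fin D.n))} (hα : IsGeodesic D.genG α)
    (hδ : IsGeodesic D.genG δ) (hαN : α.length = N + 1) (hδN : δ.length = N + 1)
    (hαδ : eval D.genG (α ++ δ) = 1) :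
    BallPath D.genG N (max (6 * k + 2) (4 * M)) (pos D.genG (α ++ δ) N)
      (pos D.genG (α ++ δ) (N + 2)) := by
  have hgen := D.generates_genG
  have hlen : (α ++ δ).length = 2 * N + 2 := by rw [List.length_append]; omega
  have htake : α = (α ++ δ).take (N + 1) := by rw [← hαN, List.take_left]
  have hdrop : δ = (α ++ δ).drop (N + 1) := by rw [← hαN, List.drop_left]
  have hN : wlen D.genG (pos D.genG (α ++ δ) N) ≤ N :=
    (wlen_eval_le _).trans (List.length_take_le _ _)
  have hN' : wlen D.genG (pos D.genG (α ++ δ) (N + 2)) ≤ N := by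
    have h := hαδ
    rw [← List.take_append_drop (N + 2) (α ++ δ), eval_append] at h
    rw [pos, eq_inv_of_mul_eq_one_left h, hgen.wlen_inv]
    refine (wlen_eval_le _).trans ?_
    rw [List.length_drop]
    omega
  generalize α ++ δ = Ω at *
  rcases D.britton hD.1 Ω hαδ with ⟨m, rfl, hm⟩ | ⟨i, e, m, pre, post, hm, rfl⟩
  · rw [length_baseWord] at hlen
    have hgeo : ¬ IsGeodesic D.genA m := by
      rw [IsGeodesic, hm, wlen_one]
      omega
    have h := D.ballPath_of_not_isGeodesic hk hfftp (N := N) (a := N + 1) (q := 1) hgeo (by omega)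
      (by omega) (by simp) (by simp [hm]; omega)
    simp only [one_mul, ← pos_baseWord] at h
    exact h.mono (le_max_left _ _)
  set σ := letterEval D.genG (D.stable i e) with hσ
  have hσ₁ : wlen D.genG σ ≤ 1 := by simpa using wlen_eval_le (gen := D.genG) [D.stable i e]
  have hpre := wlen_eval_le (gen := D.genG) pre
  have hpost := wlen_eval_le (gen := D.genG) post
  have hlen' : pre.length + m.length + post.length = 2 * N := by
    simp only [List.length_append, List.length_cons, List.length_nil, length_baseWord] at hlen
    omega
  have hpreN : pre.length ≤ N := by
    by_contra! h
    refine D.not_hasPinch_of_isGeodesic hD hδ ⟨i, e, m, pre.drop (N + 1), post, hm, ?_⟩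
    rw [hdrop, List.append_assoc, List.append_assoc, List.drop_append_of_le_length (by omega)]
  have hpreN' : N ≤ pre.length + m.length := by
    by_contra! h
    refine D.not_hasPinch_of_isGeodesic hD hα
      ⟨i, e, m, pre, post.take (N + 1 - (pre.length + m.length + 2)), hm, ?_⟩
    rw [htake, List.take_append, List.take_of_length_le]
    · congr 3
      simp
      omega
    · simp
      omega
  obtain ⟨a, rfl⟩ := Nat.exists_eq_add_of_le hpreN
  have hpos : ∀ s ≤ m.length, pos D.genG
      (pre ++ (D.stable i e :: (D.baseWord m ++ [D.stable i (-e)])) ++ post)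
      (pre.length + (s + 1)) = eval D.genG pre * σ * D.incl (pos D.genA m s) := by
    intro s hs
    rw [pos, List.append_assoc, List.take_length_add_append, List.cons_append, List.take_succ_cons,
      List.append_assoc, List.take_append_of_le_length (by simpa using hs), eval_append, eval_cons,
      ← pos_baseWord, pos, mul_assoc]
  have hend : eval D.genG pre * (σ * D.incl (eval D.genA m) * σ⁻¹) = (eval D.genG post)⁻¹ := by
    simp only [eval_append, eval_cons, eval_baseWord, letterEval_stable_neg, eval_nil,
      mul_one] at hαδ
    rw [← eq_inv_of_mul_eq_one_left hαδ, hσ]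
    simp only [mul_assoc]
  by_cases hgeo : IsGeodesic D.genA m
  · obtain ⟨ps, rfl, hps⟩ := D.exists_stripEdges hD.2.1 i e hgeo hm
    refine (D.ballPath_of_strip hD.2.2 hM hps hσ (z := eval D.genG pre) (a := a) (by omega)
      (by omega) ?_ hN hN' ?_ ?_).mono (le_max_right _ _)
    · rw [hend, hgen.wlen_inv]
      omega
    · rcases Nat.eq_zero_or_pos a with rfl | ha
      · exact Or.inl ⟨rfl, by simp [pos]⟩
      · refine Or.inr ⟨ha, ?_⟩
        rw [← hpos _ (by omega), Nat.sub_add_cancel ha]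
    · rcases Nat.lt_or_ge a ps.flatten.length with ha | ha
      · exact Or.inr ⟨ha, by rw [← hpos _ ha]; rfl⟩
      · refine Or.inl ⟨by omega, ?_⟩
        rw [pos, List.take_left' (by
          simp only [List.length_append, List.length_cons, length_baseWord, List.length_nil]
          omega)]
        simp [letterEval_stable_neg, eval_baseWord, mul_assoc, hσ]
  · have ha : 1 ≤ a := by
      by_contra! h
      refine hgeo (D.isGeodesic_of_baseWord (IsGeodesic.of_append hgen (u := [])
        (w := D.stable i (-e) :: post) ?_))
      convert hδ using 1
      rw [hdrop, List.append_assoc pre, show pre.length + a + 1 = pre.length + 1 by omega,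
        List.drop_length_add_append]
      simp
    have ham : a + 1 ≤ m.length := by
      by_contra! h
      refine hgeo (D.isGeodesic_of_baseWord (IsGeodesic.of_append hgen
        (u := pre ++ [D.stable i e]) (w := []) ?_))
      convert hα using 1
      rw [htake, List.append_assoc pre _ post,
        show pre.length + a + 1 = pre.length + (m.length + 1) by omega, List.take_length_add_append]
      simp
    have h := D.ballPath_of_not_isGeodesic hk hfftp (N := pre.length + a) (a := a)
      (q := eval D.genG pre * σ) hgeo ha ham ?_ ?_
    · rw [← hpos _ (by omega), ← hpos _ (by omega), Nat.sub_add_cancel ha] at h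
      exact h.mono (le_max_left _ _)
    · have := hgen.wlen_mul_le (eval D.genG pre) σ
      omega
    · have h : eval D.genG pre * σ * D.incl (eval D.genA m) = (eval D.genG post)⁻¹ * σ := by
        rw [← hend]
        group
      have h' := hgen.wlen_mul_le (eval D.genG post)⁻¹ σ
      rw [hgen.wlen_inv] at h'
      rw [h]
      omega

theorem wlen_basis_le (hD : D.StripEquidistant) {M : ℕ}
    (hM : ∀ i j, wlen D.genA (D.u i j) ≤ M) (i : Fin D.n) (e : ℤˣ) (j : Fin (D.m i)) :
    wlen D.genA (D.basis i e j) ≤ M := by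
  rcases Int.units_eq_one_or e with rfl | rfl
  · exact (hD i j).symm.trans_le (hM i j)
  · exact hM i j

end MHNNData

open MHNNData in
/-- An isometric multiple HNN extension of a finitely presented base group
whose base group has the synchronous falsification by fellow traveler property with even
constant `k` is almost convex with respect to `X ∪ {s_1, …, s_n}` with almost convexity
constant at most `max (6k+2) (4M)`, where `M` is the maximal word length of a free
generator of an associated subgroup. -/
theorem isometric_mhnn_almostConvex_constant (D : MHNNData) (hfp : D.R.Finite)
    (hiso : D.IsIsometric)
    (k : ℕ) (hk : 0 < k) (hkeven : Even k) (hfftp : SynchFFTP D.genA k)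
    (M : ℕ)
    (hM : letI := D.fin
          M = Finset.univ.sup
            fun p : Σ i : Fin D.n, Fin (D.m i) => wlen D.genA (D.u p.1 p.2)) :
    AlmostConvexWith D.genG (max (6 * k + 2) (4 * M)) := by
  intro N _ g g' hg hg' hd
  have hgen := D.generates_genG
  change BallPath D.genG N _ g g'
  obtain ⟨w, hw, hwl⟩ := hgen.exists_eval_eq (g⁻¹ * g')
  by_cases hd₁ : wlen D.genG (g⁻¹ * g') ≤ 1
  · exact (hgen.ballPath hd₁ (by omega)).mono (le_max_of_le_left (by omega))
  obtain ⟨x, y, rfl⟩ := List.length_eq_two.1 (show w.length = 2 by omega)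
  have hy : g * letterEval D.genG x * letterEval D.genG y = g' := by
    simp only [eval_cons, eval_nil, mul_one] at hw
    rw [mul_assoc, hw, mul_inv_cancel_left]
  have hx₁ : wlen D.genG (g⁻¹ * (g * letterEval D.genG x)) ≤ 1 := by
    simpa using wlen_eval_le (gen := D.genG) [x]
  have hy₁ : wlen D.genG ((g * letterEval D.genG x)⁻¹ * g') ≤ 1 := by
    rw [← hy, inv_mul_cancel_left]
    simpa using wlen_eval_le (gen := D.genG) [y]
  have hp := hgen.wlen_le_add g (g * letterEval D.genG x)
  by_cases hpN : wlen D.genG (g * letterEval D.genG x) ≤ N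
  · exact ((hgen.ballPath hx₁ (by omega)).trans (hgen.ballPath hy₁ (by omega))).mono
      (le_max_of_le_left (by omega))
  obtain ⟨v, rfl, hv⟩ := hgen.exists_eval_eq g
  obtain ⟨v', rfl, hv'⟩ := hgen.exists_eval_eq g'
  have hx : eval D.genG (v ++ [x]) = eval D.genG v * letterEval D.genG x := by simp
  have hy' : eval D.genG (y :: invWord v') = (eval D.genG v * letterEval D.genG x)⁻¹ := by
    rw [eval_cons, eval_invWord, ← hy]
    group
  have hM' : ∀ i j, wlen D.genA (D.u i j) ≤ M := fun i j => hM ▸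
    Finset.le_sup (f := fun p : Σ i : Fin D.n, Fin (D.m i) => wlen D.genA (D.u p.1 p.2))
      (Finset.mem_univ ⟨i, j⟩)
  have h := D.ballPath_of_bigon hiso hkeven hfftp (D.wlen_basis_le hiso.2.2 hM') (N := N)
    (α := v ++ [x]) (δ := y :: invWord v') ?_ ?_ ?_ ?_ ?_
  · convert h using 1
    · rw [pos, List.append_assoc, List.take_left' (by omega)]
    · rw [pos, List.append_cons, List.take_left' (by simp; omega)]
      rw [eval_append, hx, eval_cons, eval_nil, mul_one, hy]
  · rw [IsGeodesic, hx, List.length_append, List.length_singleton]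
    omega
  · rw [IsGeodesic, hy', hgen.wlen_inv, List.length_cons, length_invWord]
    omega
  · rw [List.length_append, List.length_singleton]
    omega
  · rw [List.length_cons, length_invWord]
    omega
  · rw [eval_append, hx, hy', mul_inv_cancel]

end ACPaper
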